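/- Let ℓ₀, ℓ₁, ℓ₂, ℓ₃ be pairwise distinct lines in ℂ², let ξⱼ ∈ ℓⱼ be nonzero vectors and z ∈ ℂ a scalar satisfying ξ₁ = ξ₃ + ξ₀ and ξ₁ = ξ₂ + z·ξ₀. Then the composition (projection onto ℓ₀ along ℓ₂) ∘ (projection onto ℓ₁ along ℓ₃) sends ξ₀ to z·ξ₀. -/

import Mathlib

/-- `p : ℂ² → ℂ²` is the linear projection onto the subspace `ℓ` along the subspace `ℓ'`:
every vector `v` decomposes as `v = p v + (v - p v)` with `p v ∈ ℓ` and `v - p v ∈ ℓ'`. -/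
def IsProjOntoAlong (ℓ ℓ' : Submodule ℂ (Fin 2 → ℂ))
    (p : (Fin 2 → ℂ) →ₗ[ℂ] (Fin 2 → ℂ)) : Prop :=
  ∀ v, p v ∈ ℓ ∧ v - p v ∈ ℓ'

/-- Distinct one-dimensional subspaces are disjoint. -/
theorem Submodule.disjoint_of_finrank_eq_one {K V : Type*} [DivisionRing K] [AddCommGroup V]
    [Module K V] {ℓ m : Submodule K V} (h : Module.finrank K ℓ = 1)
    (hm : Module.finrank K m = 1) (hne : ℓ ≠ m) : Disjoint ℓ m :=
  (Submodule.isAtom_iff_finrank_eq_one.2 h).disjoint_of_ne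
    (Submodule.isAtom_iff_finrank_eq_one.2 hm) hne

/-- The value of a projection is determined by the decomposition of the vector. -/
theorem IsProjOntoAlong.apply_eq {ℓ m : Submodule ℂ (Fin 2 → ℂ)}
    {p : (Fin 2 → ℂ) →ₗ[ℂ] (Fin 2 → ℂ)} (hp : IsProjOntoAlong ℓ m p) (hd : Disjoint ℓ m)
    {v w : Fin 2 → ℂ} (hw : w ∈ ℓ) (hvw : v - w ∈ m) : p v = w := by
  obtain ⟨h, hm⟩ := hp v
  refine sub_eq_zero.1 (Submodule.disjoint_def.1 hd _ (ℓ.sub_mem h hw) ?_)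
  simpa using m.sub_mem hvw hm

/-- Let `ℓ₀, ℓ₁, ℓ₂, ℓ₃` be pairwise distinct lines in `ℂ²`, let `ξⱼ ∈ ℓⱼ` be nonzero
vectors and `z ∈ ℂ` a scalar with `ξ₁ = ξ₃ + ξ₀` and `ξ₁ = ξ₂ + z • ξ₀`.  Then
(projection onto `ℓ₀` along `ℓ₂`) ∘ (projection onto `ℓ₁` along `ℓ₃`) sends `ξ₀` to `z • ξ₀`. -/
theorem stmt1 (ℓ₀ ℓ₁ ℓ₂ ℓ₃ : Submodule ℂ (Fin 2 → ℂ))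
    (hr₀ : Module.finrank ℂ ℓ₀ = 1) (hr₁ : Module.finrank ℂ ℓ₁ = 1)
    (hr₂ : Module.finrank ℂ ℓ₂ = 1) (hr₃ : Module.finrank ℂ ℓ₃ = 1)
    (h₀₁ : ℓ₀ ≠ ℓ₁) (h₀₂ : ℓ₀ ≠ ℓ₂) (h₀₃ : ℓ₀ ≠ ℓ₃)
    (h₁₂ : ℓ₁ ≠ ℓ₂) (h₁₃ : ℓ₁ ≠ ℓ₃) (h₂₃ : ℓ₂ ≠ ℓ₃)
    (ξ₀ ξ₁ ξ₂ ξ₃ : Fin 2 → ℂ) (z : ℂ)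
    (hξ₀ : ξ₀ ∈ ℓ₀) (hξ₁ : ξ₁ ∈ ℓ₁) (hξ₂ : ξ₂ ∈ ℓ₂) (hξ₃ : ξ₃ ∈ ℓ₃)
    (hn₀ : ξ₀ ≠ 0) (hn₁ : ξ₁ ≠ 0) (hn₂ : ξ₂ ≠ 0) (hn₃ : ξ₃ ≠ 0)
    (e₁ : ξ₁ = ξ₃ + ξ₀) (e₂ : ξ₁ = ξ₂ + z • ξ₀)
    (p q : (Fin 2 → ℂ) →ₗ[ℂ] (Fin 2 → ℂ))
    (hp : IsProjOntoAlong ℓ₀ ℓ₂ p)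
    (hq : IsProjOntoAlong ℓ₁ ℓ₃ q) :
    p (q ξ₀) = z • ξ₀ := by
  have hq₀ : q ξ₀ = ξ₁ := by
    refine hq.apply_eq (Submodule.disjoint_of_finrank_eq_one hr₁ hr₃ h₁₃) hξ₁ ?_
    simpa [e₁] using hξ₃
  rw [hq₀]
  refine hp.apply_eq (Submodule.disjoint_of_finrank_eq_one hr₀ hr₂ h₀₂) (ℓ₀.smul_mem z hξ₀) ?_
  simpa [e₂] using hξ₂
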